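/- Let E be a centrally orthocomplete pseudo-effect algebra. If a is an atom of E, then the central cover γa is an atom of the Boolean algebra Γ(E). Consequently, if E is atomic, then Γ(E) is atomic. -/

import Mathlib

namespace PEApaper

/-- The bare data of a partial-addition structure: a partial binary operation
(encoded via `Option`) together with constants `0` and `1`. -/
structure PartialStruct (E : Type) where
  padd : E → E → Option E
  zero : E
  one : E

namespace PartialStruct

variable {E : Type}

/-- `a ≤ b` iff `a + c = b` for some `c`. -/
def le (P : PartialStruct E) (a b : E) : Prop := ∃ c, P.padd a c = some b

/-- `m` is the greatest lower bound (meet `a ∧ b`) of `a` and `b`. -/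
def IsMeet (P : PartialStruct E) (a b m : E) : Prop :=
  P.le m a ∧ P.le m b ∧ ∀ x, P.le x a → P.le x b → P.le x m

/-- `j` is the least upper bound (join `a ∨ b`) of `a` and `b`. -/
def IsJoin (P : PartialStruct E) (a b j : E) : Prop :=
  P.le a j ∧ P.le b j ∧ ∀ x, P.le a x → P.le b x → P.le j x

/-- `s` is the supremum of the set `S`. -/
def IsSup (P : PartialStruct E) (S : Set E) (s : E) : Prop :=
  (∀ x ∈ S, P.le x s) ∧ ∀ u, (∀ x ∈ S, P.le x u) → P.le s u

/-- Left-associated partial sum of a list, continuing from `acc`. -/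
def IsSumFrom (P : PartialStruct E) : E → List E → E → Prop
  | acc, [], s => s = acc
  | acc, a :: l, s => ∃ t, P.padd acc a = some t ∧ IsSumFrom P t l s

/-- `s` is the (left-associated) orthosum `e₁ + e₂ + ⋯ + eₙ` of the list. -/
def IsSumList (P : PartialStruct E) (l : List E) (s : E) : Prop :=
  match l with
  | [] => s = P.zero
  | a :: t => IsSumFrom P a t s

/-- `c` is a central element: there is a PEA-isomorphism
`f : E → E[0,c] × E[0,c∼]` with `f c = (c,0)` such that `f x = (x₁,x₂)`
implies `x = x₁ + x₂`.  The isomorphism onto the product of the two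
interval pseudo-effect algebras is spelled out explicitly. -/
def IsCentral (P : PartialStruct E) (c : E) : Prop :=
  ∃ cs, P.padd c cs = some P.one ∧
    ∃ f : E → E × E,
      (∀ x, P.le (f x).1 c ∧ P.le (f x).2 cs) ∧
      Function.Injective f ∧
      (∀ y : E × E, P.le y.1 c → P.le y.2 cs → ∃ x, f x = y) ∧
      f c = (c, P.zero) ∧
      f P.one = (c, cs) ∧
      (∀ x, P.padd (f x).1 (f x).2 = some x) ∧
      (∀ a b ab, P.padd a b = some ab →
        P.padd (f a).1 (f b).1 = some (f ab).1 ∧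
        P.padd (f a).2 (f b).2 = some (f ab).2) ∧
      (∀ a b s t, P.padd (f a).1 (f b).1 = some s → P.le s c →
        P.padd (f a).2 (f b).2 = some t → P.le t cs →
        ∃ ab, P.padd a b = some ab)

/-- The center `Γ(E)`. -/
def center (P : PartialStruct E) : Set E := {c | P.IsCentral c}

/-- The central interval `Γ(E)[0,c] = Γ(E) ∩ E[0,c]`. -/
def centerIntervalSet (P : PartialStruct E) (c : E) : Set E :=
  {x | P.IsCentral x ∧ P.le x c}

/-- A Γ-orthogonal family: one dominated elementwise by a pairwise
disjoint family of central elements. -/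
def GammaOrthogonal (P : PartialStruct E) {I : Type} (e : I → E) : Prop :=
  ∃ c : I → E, (∀ i, P.IsCentral (c i)) ∧
    (∀ i j, i ≠ j → P.IsMeet (c i) (c j) P.zero) ∧
    ∀ i, P.le (e i) (c i)

/-- Centrally orthocomplete: every Γ-orthogonal family has a supremum. -/
def IsCOPEA (P : PartialStruct E) : Prop :=
  ∀ (I : Type) (e : I → E), P.GammaOrthogonal e → ∃ s, P.IsSup (Set.range e) s

/-- `c` is the central cover of `e`: the smallest central element above `e`. -/
def IsCentralCover (P : PartialStruct E) (c e : E) : Prop :=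
  P.IsCentral c ∧ P.le e c ∧ ∀ d, P.IsCentral d → P.le e d → P.le c d

/-- `[Q]`: the set of all suprema of Γ-orthogonal families of elements of `Q`. -/
def bra (P : PartialStruct E) (Q : Set E) : Set E :=
  {s | ∃ (I : Type) (e : I → E), (∀ i, e i ∈ Q) ∧ P.GammaOrthogonal e ∧
    P.IsSup (Set.range e) s}

/-- `Q^γ = {q ∧ c : q ∈ Q, c ∈ Γ(E)}`. -/
def gammaClosure (P : PartialStruct E) (Q : Set E) : Set E :=
  {m | ∃ q ∈ Q, ∃ c, P.IsCentral c ∧ P.IsMeet q c m}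

/-- `Q↓ = ⋃_{q ∈ Q} E[0,q]`. -/
def downSet (P : PartialStruct E) (Q : Set E) : Set E :=
  {e | ∃ q ∈ Q, P.le e q}

/-- `Q' = {e ∈ E : q ∧ e = 0 for all q ∈ Q}`. -/
def commutant (P : PartialStruct E) (Q : Set E) : Set E :=
  {e | ∀ q ∈ Q, P.IsMeet q e P.zero}

/-- A type-determining (TD) set: `K = [K] = K^γ`. -/
def IsTD (P : PartialStruct E) (K : Set E) : Prop :=
  P.bra K = K ∧ P.gammaClosure K = K

/-- A strongly type-determining (STD) set: `K = [K] = K↓`. -/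
def IsSTD (P : PartialStruct E) (K : Set E) : Prop :=
  P.bra K = K ∧ P.downSet K = K

/-- `c` is the type-cover of `K` (w.r.t. the central cover map `γ`):
the unique central element with `γK = Γ(E)[0,c]`. -/
def IsTypeCover (P : PartialStruct E) (γ : E → E) (K : Set E) (c : E) : Prop :=
  P.IsCentral c ∧ γ '' K = P.centerIntervalSet c

/-- An atom: a nonzero element with no proper nonzero subelement. -/
def IsAtom' (P : PartialStruct E) (a : E) : Prop :=
  a ≠ P.zero ∧ ∀ x, P.le x a → x = P.zero ∨ x = a

end PartialStruct

/-- A PEA-isomorphism between two partial-addition structures: a bijective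
morphism whose inverse is a morphism. -/
structure IsPEAIso {A B : Type} (P : PartialStruct A) (Q : PartialStruct B)
    (f : A → B) : Prop where
  bijective : Function.Bijective f
  map_one : f P.one = Q.one
  map_add : ∀ a b ab, P.padd a b = some ab → Q.padd (f a) (f b) = some (f ab)
  rev_add : ∀ a b s, Q.padd (f a) (f b) = some s → ∃ ab, P.padd a b = some ab

open scoped Classical in
/-- The (coordinatewise) product of a family of partial structures. -/
noncomputable def prodStruct {I : Type} {A : I → Type}
    (Ps : ∀ i, PartialStruct (A i)) : PartialStruct (∀ i, A i) where
  padd a b :=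
    if h : ∀ i, ∃ s, (Ps i).padd (a i) (b i) = some s
    then some fun i => Classical.choose (h i)
    else none
  zero := fun i => (Ps i).zero
  one := fun i => (Ps i).one

/-- A pseudo-effect algebra. -/
structure PEA (E : Type) extends PartialStruct E where
  assoc_def : ∀ a b c : E,
    (∃ ab, padd a b = some ab ∧ ∃ x, padd ab c = some x) ↔
    (∃ bc, padd b c = some bc ∧ ∃ y, padd a bc = some y)
  assoc_eq : ∀ a b c ab bc x y, padd a b = some ab → padd ab c = some x →
    padd b c = some bc → padd a bc = some y → x = y
  exu_right : ∀ a : E, ∃! d, padd a d = some one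
  exu_left : ∀ a : E, ∃! e, padd e a = some one
  shift : ∀ a b ab, padd a b = some ab →
    (∃ d, padd d a = some ab) ∧ (∃ e, padd b e = some ab)
  one_add : ∀ a x, padd one a = some x → a = zero
  add_one : ∀ a x, padd a one = some x → a = zero

namespace PEA

variable {E : Type} (P : PEA E)

/-- Shorthand for the underlying partial structure. -/
abbrev ps : PartialStruct E := P.toPartialStruct

theorem one_add_zero : P.padd P.one P.zero = some P.one := by
  obtain ⟨d, hd, -⟩ := P.exu_right P.one
  have h := P.one_add d P.one hd
  rwa [h] at hd

theorem zero_add_one : P.padd P.zero P.one = some P.one := by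
  obtain ⟨e, he, -⟩ := P.exu_left P.one
  have h := P.add_one e P.one he
  rwa [h] at he

theorem padd_zero (a : E) : P.padd a P.zero = some a := by
  obtain ⟨e, he, -⟩ := P.exu_left a
  have h1 : ∃ ab, P.padd e a = some ab ∧ ∃ x, P.padd ab P.zero = some x :=
    ⟨P.one, he, P.one, P.one_add_zero⟩
  obtain ⟨t, ht, y, hy⟩ := (P.assoc_def e a P.zero).mp h1
  have hxy : P.one = y :=
    P.assoc_eq e a P.zero P.one t P.one y he P.one_add_zero ht hy
  obtain ⟨d, hd, hu⟩ := P.exu_right e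
  have hta : t = a := by
    have h2 : t = d := hu t (by rw [← hxy] at hy; exact hy)
    have h3 : a = d := hu a he
    rw [h2, h3]
  rwa [hta] at ht

theorem zero_padd (a : E) : P.padd P.zero a = some a := by
  obtain ⟨d, hd, -⟩ := P.exu_right a
  have h1 : ∃ bc, P.padd a d = some bc ∧ ∃ y, P.padd P.zero bc = some y :=
    ⟨P.one, hd, P.one, P.zero_add_one⟩
  obtain ⟨t, ht, y, hy⟩ := (P.assoc_def P.zero a d).mpr h1
  have hxy : y = P.one :=
    P.assoc_eq P.zero a d t P.one y P.one ht hy hd P.zero_add_one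
  obtain ⟨e, he, hu⟩ := P.exu_left d
  have hta : t = a := by
    have h2 : t = e := hu t (by rw [hxy] at hy; exact hy)
    have h3 : a = e := hu a hd
    rw [h2, h3]
  rwa [hta] at ht

theorem zero_le (a : E) : P.ps.le P.zero a := ⟨a, P.zero_padd a⟩

theorem le_refl (a : E) : P.ps.le a a := ⟨P.zero, P.padd_zero a⟩

open scoped Classical in
/-- The interval pseudo-effect algebra `E[0,p]` as a partial structure on
the subtype `{x // x ≤ p}`; the sum is defined iff it is defined in `E`
and lies below `p`, and the unit is `p`. -/
noncomputable def intervalStruct (p : E) :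
    PartialStruct {x : E // P.ps.le x p} where
  padd a b := (P.padd a.1 b.1).bind fun s =>
    if h : P.ps.le s p then some ⟨s, h⟩ else none
  zero := ⟨P.zero, P.zero_le p⟩
  one := ⟨p, P.le_refl p⟩

end PEA

/-- The order relation of a complete Boolean algebra structure, made explicit. -/
def cbaLe {X : Type} (inst : CompleteBooleanAlgebra X) (a b : X) : Prop :=
  @LE.le X (by letI := inst; exact inferInstance) a b

end PEApaper

namespace PEApaper.PEA

variable {E : Type} (P : PEA E)

theorem padd_left_cancel {a b c t : E} (hb : P.padd a b = some t) (hc : P.padd a c = some t) :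
    b = c := by
  obtain ⟨e, he, -⟩ := P.exu_left t
  obtain ⟨u, hu, x, hx⟩ := (P.assoc_def e a b).mpr ⟨t, hb, P.one, he⟩
  obtain ⟨v, hv, y, hy⟩ := (P.assoc_def e a c).mpr ⟨t, hc, P.one, he⟩
  have hx1 := P.assoc_eq e a b u t x P.one hu hx hb he
  have hy1 := P.assoc_eq e a c v t y P.one hv hy hc he
  have huv : u = v := Option.some.inj (hu.symm.trans hv)
  subst hx1 hy1 huv
  exact (P.exu_right u).unique hx hy

theorem eq_zero_of_padd_eq_zero {a b : E} (h : P.padd a b = some P.zero) : a = P.zero := by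
  obtain ⟨x, hx, -⟩ := (P.assoc_def P.one a b).mpr ⟨P.zero, h, P.one, P.one_add_zero⟩
  exact P.one_add a x hx

theorem eq_zero_of_le_zero {a : E} (h : P.ps.le a P.zero) : a = P.zero :=
  let ⟨_, hb⟩ := h
  P.eq_zero_of_padd_eq_zero hb

theorem le_trans {a b c : E} (hab : P.ps.le a b) (hbc : P.ps.le b c) : P.ps.le a c := by
  obtain ⟨x, hx⟩ := hab
  obtain ⟨y, hy⟩ := hbc
  obtain ⟨z, hz, w, hw⟩ := (P.assoc_def a x y).mp ⟨b, hx, c, hy⟩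
  have hcw := P.assoc_eq a x y b z c w hx hy hz hw
  subst hcw
  exact ⟨z, hw⟩

theorem le_antisymm {a b : E} (hab : P.ps.le a b) (hba : P.ps.le b a) : a = b := by
  obtain ⟨x, hx⟩ := hab
  obtain ⟨y, hy⟩ := hba
  obtain ⟨z, hz, w, hw⟩ := (P.assoc_def a x y).mp ⟨b, hx, a, hy⟩
  have haw := P.assoc_eq a x y b z a w hx hy hz hw
  subst haw
  have hz0 : z = P.zero := P.padd_left_cancel hw (P.padd_zero a)
  subst hz0
  have hx0 := P.eq_zero_of_padd_eq_zero hz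
  subst hx0
  exact Option.some.inj ((P.padd_zero a).symm.trans hx)

/-- A central element `c` has a central complement `d` disjoint from it, and every element
splits as a sum of an element below `c` and an element below `d`. -/
theorem exists_central_compl {c : E} (hc : P.ps.IsCentral c) :
    ∃ d, P.ps.IsCentral d ∧ (P.ps.le c d → c = P.zero) ∧
      ∀ x, ∃ y z, P.ps.le y c ∧ P.ps.le z d ∧ P.padd y z = some x := by
  obtain ⟨d, -, f, hle, hinj, hsurj, hfc, hf1, hsum, hadd, hrev⟩ := hc
  have hleft : ∀ y, P.ps.le y c → f y = (y, P.zero) := by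
    intro y hy
    obtain ⟨x, hx⟩ := hsurj (y, P.zero) hy (P.zero_le d)
    have hs := hsum x
    rw [hx] at hs
    have hyx : y = x := Option.some.inj ((P.padd_zero y).symm.trans hs)
    rwa [← hyx] at hx
  have hright : ∀ z, P.ps.le z d → f z = (P.zero, z) := by
    intro z hz
    obtain ⟨x, hx⟩ := hsurj (P.zero, z) (P.zero_le c) hz
    have hs := hsum x
    rw [hx] at hs
    have hzx : z = x := Option.some.inj ((P.zero_padd z).symm.trans hs)
    rwa [← hzx] at hx
  have hcomm : ∀ x, P.padd (f x).2 (f x).1 = some x := by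
    intro x
    have h1 := hleft _ (hle x).1
    have h2 := hright _ (hle x).2
    have hs1 : P.padd (f (f x).2).1 (f (f x).1).1 = some (f x).1 := by
      rw [h1, h2]; exact P.zero_padd _
    have hs2 : P.padd (f (f x).2).2 (f (f x).1).2 = some (f x).2 := by
      rw [h1, h2]; exact P.padd_zero _
    obtain ⟨s, hs⟩ := hrev _ _ _ _ hs1 (hle x).1 hs2 (hle x).2
    obtain ⟨ht1, ht2⟩ := hadd _ _ _ hs
    have hsx : s = x := hinj <| Prod.ext
      (Option.some.inj (ht1.symm.trans hs1)) (Option.some.inj (ht2.symm.trans hs2))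
    rw [hs, hsx]
  refine ⟨d, ⟨c, ?_, fun x => (f x).swap, fun x => (hle x).symm,
    Prod.swap_injective.comp hinj, ?_, ?_, ?_, hcomm, fun a b ab h => (hadd a b ab h).symm,
    fun a b s t hs hsd ht htc => hrev a b t s ht htc hs hsd⟩, ?_,
    fun x => ⟨_, _, (hle x).1, (hle x).2, hsum x⟩⟩
  · simpa only [hf1] using hcomm P.one
  · intro y hy1 hy2
    obtain ⟨x, hx⟩ := hsurj y.swap hy2 hy1
    exact ⟨x, by simp [hx]⟩
  · simp [hright d (P.le_refl d)]
  · simp [hf1]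
  · intro hcd
    exact congrArg Prod.fst (hfc.symm.trans (hright c hcd))

/-- A central element lying below the central cover of an atom is zero or the whole cover. -/
theorem eq_zero_or_eq_of_le_centralCover {a g c : E} (ha : P.ps.IsAtom' a)
    (hg : P.ps.IsCentralCover g a) (hc : P.ps.IsCentral c) (hcg : P.ps.le c g) :
    c = P.zero ∨ c = g := by
  obtain ⟨d, hd, hcd, hsplit⟩ := P.exists_central_compl hc
  obtain ⟨y, z, hy, hz, hyz⟩ := hsplit a
  rcases ha.2 y ⟨z, hyz⟩ with rfl | rfl
  · have hza : z = a := Option.some.inj ((P.zero_padd z).symm.trans hyz)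
    subst hza
    exact .inl (hcd (P.le_trans hcg (hg.2.2 d hd hz)))
  · exact .inr (P.le_antisymm hcg (hg.2.2 c hc hy))

theorem centralCover_ne_zero {a g : E} (ha : P.ps.IsAtom' a)
    (hg : P.ps.IsCentralCover g a) : g ≠ P.zero := by
  rintro rfl
  exact ha.1 (P.eq_zero_of_le_zero hg.2.1)

end PEApaper.PEA

open PEApaper PEApaper.PartialStruct in
/-- Lemma 6.1: in a COPEA, the central cover of an atom is an atom of the
Boolean algebra `Γ(E)`; consequently if `E` is atomic then `Γ(E)` is atomic. -/
theorem stmt17 {E : Type} (P : PEA E) (hco : P.ps.IsCOPEA)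
    (γ : E → E) (hγ : ∀ e, P.ps.IsCentralCover (γ e) e) :
    (∀ a, P.ps.IsAtom' a →
      γ a ≠ P.ps.zero ∧
        ∀ c, P.ps.IsCentral c → P.ps.le c (γ a) →
          c = P.ps.zero ∨ c = γ a) ∧
    ((∀ e, e ≠ P.ps.zero → ∃ a, P.ps.IsAtom' a ∧ P.ps.le a e) →
      ∀ c, P.ps.IsCentral c → c ≠ P.ps.zero →
        ∃ b, P.ps.IsCentral b ∧ b ≠ P.ps.zero ∧
          (∀ x, P.ps.IsCentral x → P.ps.le x b →
            x = P.ps.zero ∨ x = b) ∧ P.ps.le b c) := by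
  refine ⟨fun a ha => ⟨P.centralCover_ne_zero ha (hγ a), fun c =>
    P.eq_zero_or_eq_of_le_centralCover ha (hγ a)⟩, fun hat c hc hc0 => ?_⟩
  obtain ⟨a, ha, hac⟩ := hat c hc0
  exact ⟨γ a, (hγ a).1, P.centralCover_ne_zero ha (hγ a),
    fun x => P.eq_zero_or_eq_of_le_centralCover ha (hγ a), (hγ a).2.2 c hc hac⟩
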